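/- Fix a positive integer n. For each N ≥ n let A_N = √(4 (log N)/n) and let R(A_N, n, N) = inf_T [ P₀(T = 1) + sup_{θ ∈ Θ(A_N, n, N)} P_θ(T = 0) ] denote the minimax risk over all tests T. Then lim_{N→∞} R(A_N, n, N) = 1/2. -/

import Mathlib

open MeasureTheory ProbabilityTheory Real Filter Topology

noncomputable section

/-- Law of the N×N Gaussian observation matrix with mean matrix θ and unit variances. -/
def PTheta (N : ℕ) (θ : Fin N → Fin N → ℝ) : Measure (Fin N → Fin N → ℝ) :=
  Measure.pi fun i => Measure.pi fun j => gaussianReal (θ i j) 1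

/-- Parameter space Θ(A, n, N). -/
def ThetaSet (A : ℝ) (n N : ℕ) : Set (Fin N → Fin N → ℝ) :=
  {θ | ∃ R C : Finset (Fin N), R.card = n ∧ C.card = n ∧
    (∀ i j, i ∈ R → j ∈ C → A ≤ θ i j) ∧
    (∀ i j, ¬(i ∈ R ∧ j ∈ C) → θ i j = 0)}

/-- Risk of the test with rejection region `T`: type-I error plus worst-case type-II error. -/
def testRisk (n N : ℕ) (A : ℝ) (T : Set (Fin N → Fin N → ℝ)) : ℝ :=
  (PTheta N 0 T).toReal + ⨆ θ : ThetaSet A n N, (PTheta N θ.1 Tᶜ).toReal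

/-- Minimax risk over all (measurable) tests. -/
def minimaxRisk (n N : ℕ) (A : ℝ) : ℝ :=
  ⨅ T : {T : Set (Fin N → Fin N → ℝ) // MeasurableSet T}, testRisk n N A T.1

/-! ### Measure theoretic preliminaries -/

/-- The product of measures with densities is the measure with product density. -/
lemma pi_withDensity_aux {ι : Type*} [Fintype ι] {E : ι → Type*} {mE : ∀ i, MeasurableSpace (E i)}
    (μ ν : ∀ i, Measure (E i)) [∀ i, IsProbabilityMeasure (μ i)] [∀ i, IsProbabilityMeasure (ν i)]
    (f : ∀ i, E i → ℝ) (hf0 : ∀ i x, 0 ≤ f i x) (hfm : ∀ i, Measurable (f i))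
    (h : ∀ i, ν i = (μ i).withDensity (fun x => ENNReal.ofReal (f i x))) :
    Measure.pi ν = (Measure.pi μ).withDensity (fun x => ENNReal.ofReal (∏ i, f i (x i))) := by
  have hintg : ∀ i, Integrable (f i) (μ i) := by
    intro i
    refine ⟨(hfm i).aestronglyMeasurable, ?_⟩
    rw [hasFiniteIntegral_iff_ofReal (ae_of_all _ (hf0 i))]
    have : ν i Set.univ = 1 := measure_univ
    rw [h i, withDensity_apply _ MeasurableSet.univ, Measure.restrict_univ] at this
    rw [this]; exact ENNReal.one_lt_top
  refine Measure.pi_eq fun s hs => ?_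
  rw [withDensity_apply _ (MeasurableSet.univ_pi hs),
    ← lintegral_indicator (MeasurableSet.univ_pi hs)]
  have h1 : ∀ x : (∀ i, E i), (Set.univ.pi s).indicator
      (fun x => ENNReal.ofReal (∏ i, f i (x i))) x
      = ENNReal.ofReal (∏ i, (s i).indicator (f i) (x i)) := by
    intro x
    by_cases hx : x ∈ Set.univ.pi s
    · rw [Set.indicator_of_mem hx]
      congr 1
      refine Finset.prod_congr rfl fun i _ => ?_
      rw [Set.indicator_of_mem (hx i (Set.mem_univ i))]
    · rw [Set.indicator_of_notMem hx]
      simp only [Set.mem_pi, Set.mem_univ, true_implies, not_forall] at hx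
      obtain ⟨i, hi⟩ := hx
      rw [Finset.prod_eq_zero (Finset.mem_univ i) (Set.indicator_of_notMem hi _)]
      simp
  simp_rw [h1]
  have hintg' : ∀ i, Integrable ((s i).indicator (f i)) (μ i) := fun i => (hintg i).indicator (hs i)
  have hnn : ∀ i x, 0 ≤ (s i).indicator (f i) x := fun i x =>
    Set.indicator_nonneg (fun y _ => hf0 i y) x
  rw [← ofReal_integral_eq_lintegral_ofReal (Integrable.fintype_prod_dep hintg')
    (ae_of_all _ fun x => Finset.prod_nonneg fun i _ => hnn i _)]
  rw [integral_fintype_prod_eq_prod, ENNReal.ofReal_prod_of_nonneg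
    (fun i _ => integral_nonneg (hnn i))]
  refine Finset.prod_congr rfl fun i _ => ?_
  rw [h i, withDensity_apply _ (hs i), ← lintegral_indicator (hs i),
    ofReal_integral_eq_lintegral_ofReal (hintg' i) (ae_of_all _ (hnn i))]
  refine lintegral_congr fun x => ?_
  by_cases hx : x ∈ s i <;> simp [hx]

lemma gaussian_tilt (θ : ℝ) : gaussianReal θ 1 =
    (gaussianReal 0 1).withDensity (fun x => ENNReal.ofReal (exp (θ * x - θ ^ 2 / 2))) := by
  rw [gaussianReal_of_var_ne_zero _ one_ne_zero, gaussianReal_of_var_ne_zero _ one_ne_zero,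
    ← withDensity_mul₀ (by fun_prop) (by fun_prop)]
  congr 1
  ext x
  simp only [gaussianPDF, gaussianPDFReal, Pi.mul_apply]
  rw [← ENNReal.ofReal_mul (by positivity), mul_assoc (√(2 * π * _))⁻¹, ← Real.exp_add]
  congr 3
  simp
  ring

/-- The linear functional with coefficient matrix `c`. -/
def lin {N : ℕ} (c x : Fin N → Fin N → ℝ) : ℝ := ∑ i, ∑ j, c i j * x i j

lemma lin_meas {N : ℕ} (c : Fin N → Fin N → ℝ) : Measurable (lin c) := by
  unfold lin; fun_prop

instance {N : ℕ} (θ : Fin N → Fin N → ℝ) : IsProbabilityMeasure (PTheta N θ) := by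
  unfold PTheta; infer_instance

lemma PTheta_density {N : ℕ} (θ : Fin N → Fin N → ℝ) : PTheta N θ =
    (PTheta N 0).withDensity (fun x => ENNReal.ofReal (exp (lin θ x - lin θ θ / 2))) := by
  unfold PTheta
  rw [pi_withDensity_aux (fun i => Measure.pi fun j => gaussianReal
      ((0 : Fin N → Fin N → ℝ) i j) 1)
    (fun i => Measure.pi fun j => gaussianReal (θ i j) 1)
    (fun i x => ∏ j, exp (θ i j * x j - (θ i j) ^ 2 / 2)) (fun i x => by positivity)
    (fun i => by fun_prop)]
  · congr 1
    ext x
    congr 1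
    simp_rw [← Real.exp_sum]
    congr 1
    simp only [lin, Finset.sum_sub_distrib, Finset.sum_div, sq]
  · intro i
    exact pi_withDensity_aux _ _ (fun j x => exp (θ i j * x - (θ i j) ^ 2 / 2))
      (fun j x => by positivity) (fun j => by fun_prop) (fun j => gaussian_tilt _)

lemma lin_law {N : ℕ} (θ c : Fin N → Fin N → ℝ) (v : NNReal) (hv : (v : ℝ) = lin c c) :
    (PTheta N θ).map (lin c) = gaussianReal (lin c θ) v := by
  have : IsProbabilityMeasure ((PTheta N θ).map (lin c)) :=
    Measure.isProbabilityMeasure_map (lin_meas c).aemeasurable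
  refine Measure.ext_of_charFun ?_
  ext t
  rw [charFun_gaussianReal, charFun_apply_real, integral_map (lin_meas c).aemeasurable
    (by fun_prop)]
  have h1 : ∀ x : Fin N → Fin N → ℝ, Complex.exp (t * (lin c x : ℝ) * Complex.I)
      = ∏ i, ∏ j, Complex.exp ((t * c i j : ℝ) * (x i j) * Complex.I) := by
    intro x
    simp_rw [← Complex.exp_sum]
    congr 1
    simp only [lin]
    push_cast
    rw [Finset.mul_sum, Finset.sum_mul]
    refine Finset.sum_congr rfl fun i _ => ?_
    rw [Finset.mul_sum, Finset.sum_mul]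
    refine Finset.sum_congr rfl fun j _ => ?_
    ring
  simp_rw [h1]
  unfold PTheta
  rw [integral_fintype_prod_eq_prod (f := fun i (y : Fin N → ℝ) =>
    ∏ j, Complex.exp ((t * c i j : ℝ) * (y j) * Complex.I))]
  simp_rw [fun i => integral_fintype_prod_eq_prod (μ := fun j => gaussianReal (θ i j) 1)
    (f := fun j (y : ℝ) => Complex.exp ((t * c i j : ℝ) * y * Complex.I)), ← charFun_apply_real,
    charFun_gaussianReal, ← Complex.exp_sum]
  congr 1
  have : ((v : ℝ) : ℂ) = (lin c c : ℝ) := by rw [hv]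
  have h2 : (v : ℂ) = (lin c c : ℝ) := this
  rw [h2]
  simp only [lin]
  push_cast
  simp_rw [Finset.sum_sub_distrib, Finset.mul_sum, Finset.sum_mul, Finset.sum_div]
  congr 1
  · refine Finset.sum_congr rfl fun i _ => Finset.sum_congr rfl fun j _ => ?_
    ring
  · refine Finset.sum_congr rfl fun i _ => Finset.sum_congr rfl fun j _ => ?_
    ring

/-- Change of measure for sets. -/
lemma PTheta_real {N : ℕ} (θ : Fin N → Fin N → ℝ) {s : Set (Fin N → Fin N → ℝ)}
    (hs : MeasurableSet s) : (PTheta N θ).real s =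
      ∫ x, s.indicator (fun x => exp (lin θ x - lin θ θ / 2)) x ∂(PTheta N 0) := by
  rw [measureReal_def, PTheta_density, withDensity_apply _ hs, integral_indicator hs,
    integral_eq_lintegral_of_nonneg_ae (ae_of_all _ fun x => (exp_pos _).le)]
  have := lin_meas θ
  fun_prop

lemma integrable_exp_lin {N : ℕ} (θ : Fin N → Fin N → ℝ) :
    Integrable (fun x => exp (lin θ x)) (PTheta N 0) := by
  have hm := lin_meas θ
  have : Integrable (fun x => exp (lin θ x - lin θ θ / 2)) (PTheta N 0) := by
    refine ⟨by fun_prop, ?_⟩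
    rw [hasFiniteIntegral_iff_ofReal (ae_of_all _ fun x => (exp_pos _).le)]
    have h : PTheta N θ Set.univ = 1 := measure_univ
    rw [PTheta_density, withDensity_apply _ MeasurableSet.univ, Measure.restrict_univ] at h
    rw [h]; exact ENNReal.one_lt_top
  refine (this.const_mul (exp (lin θ θ / 2))).congr (ae_of_all _ fun x => ?_)
  simp only [← exp_add]
  congr 1; ring

lemma integral_exp_lin {N : ℕ} (θ : Fin N → Fin N → ℝ) :
    ∫ x, exp (lin θ x) ∂(PTheta N 0) = exp (lin θ θ / 2) := by
  have h := PTheta_real θ MeasurableSet.univ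
  simp only [Set.indicator_univ, probReal_univ, exp_sub] at h
  rw [integral_div] at h
  have := exp_pos (lin θ θ / 2)
  field_simp at h
  exact h.symm

/-- Functions of two linear functionals with disjoint supports are independent. -/
lemma lin_indep {N : ℕ} (c d : Fin N → Fin N → ℝ) (h : ∀ i j, c i j = 0 ∨ d i j = 0) :
    IndepFun (lin c) (lin d) (PTheta N 0) := by
  classical
  have hI : iIndepFun (fun (p : Fin N × Fin N) (x : Fin N → Fin N → ℝ) => x p.1 p.2)
      (PTheta N 0) := by
    have := iIndepFun_uncurry_infinitePi' (X := fun (i j : Fin N) (x : ℝ) => x)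
      (fun i j => gaussianReal ((0 : Fin N → Fin N → ℝ) i j) 1) (fun i j => measurable_id)
    simp only [Measure.infinitePi_eq_pi] at this
    exact this
  set S : Finset (Fin N × Fin N) := Finset.univ.filter fun p => c p.1 p.2 ≠ 0
  set T : Finset (Fin N × Fin N) := Finset.univ.filter fun p => d p.1 p.2 ≠ 0
  have hST : Disjoint S T := by
    rw [Finset.disjoint_left]
    intro p hp hq
    simp only [S, T, Finset.mem_filter, Finset.mem_univ, true_and] at hp hq
    rcases h p.1 p.2 with h | h <;> contradiction
  have := hI.indepFun_finset S T hST (fun p => by fun_prop)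
  have key : ∀ (c : Fin N → Fin N → ℝ) (x : Fin N → Fin N → ℝ), lin c x =
      ∑ p : (Finset.univ.filter fun p : Fin N × Fin N => c p.1 p.2 ≠ 0),
        c p.1.1 p.1.2 * x p.1.1 p.1.2 := by
    intro c x
    rw [Finset.sum_coe_sort _ (fun p : Fin N × Fin N => c p.1 p.2 * x p.1 p.2),
      Finset.sum_filter_of_ne, Fintype.sum_prod_type]
    · rfl
    · intro p _ hp h0
      exact hp (by simp [h0])
  have h2 := this.comp (φ := fun y : S → ℝ => ∑ p : S, c p.1.1 p.1.2 * y p)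
    (ψ := fun y : T → ℝ => ∑ p : T, d p.1.1 p.1.2 * y p) (by fun_prop) (by fun_prop)
  have e1 : lin c = (fun y : S → ℝ => ∑ p : S, c p.1.1 p.1.2 * y p) ∘
      (fun (x : Fin N → Fin N → ℝ) (p : S) => x p.1.1 p.1.2) := by
    ext x; exact key c x
  have e2 : lin d = (fun y : T → ℝ => ∑ p : T, d p.1.1 p.1.2 * y p) ∘
      (fun (x : Fin N → Fin N → ℝ) (p : T) => x p.1.1 p.1.2) := by
    ext x; exact key d x
  rw [e1, e2]
  exact h2

/-! ### One dimensional Gaussian facts -/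

lemma gauss_reflect (m s : ℝ) (v : NNReal) :
    (gaussianReal m v).real (Set.Iic s) = (gaussianReal 0 v).real (Set.Ici (m - s)) := by
  have h := gaussianReal_map_const_sub (μ := 0) (v := v) m
  rw [sub_zero] at h
  rw [← h, map_measureReal_apply (by fun_prop) measurableSet_Iic]
  congr 1
  ext x
  simp only [Set.mem_preimage, Set.mem_Iic, Set.mem_Ici]
  constructor <;> intro h <;> linarith

lemma gauss_Ici (s : ℝ) (v : NNReal) (hv : v ≠ 0) :
    (gaussianReal 0 v).real (Set.Ici s) = (gaussianReal 0 v).real (Set.Ioi s) := by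
  have := nullSingletonClass_gaussianReal (μ := 0) hv
  exact (measureReal_congr Ioi_ae_eq_Ici).symm

lemma gauss_half (v : NNReal) (hv : v ≠ 0) : (gaussianReal 0 v).real (Set.Ici 0) = 1 / 2 := by
  have h1 := gauss_reflect 0 0 v
  rw [sub_zero] at h1
  have h2 := gauss_Ici 0 v hv
  have h3 := probReal_compl_eq_one_sub (μ := gaussianReal 0 v) (measurableSet_Iic (a := (0:ℝ)))
  rw [Set.compl_Iic] at h3
  linarith

lemma gauss_mills (v : NNReal) (hv : v ≠ 0) (s : ℝ) (hs : 0 < s) :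
    (gaussianReal 0 v).real (Set.Ici s) ≤ √v / s * exp (-s ^ 2 / (2 * v)) := by
  have hv' : (0 : ℝ) < v := lt_of_le_of_ne v.2 (fun h => hv (NNReal.eq h.symm))
  rw [gauss_Ici s v hv, measureReal_def, gaussianReal_apply_eq_integral _ hv,
    ENNReal.toReal_ofReal (setIntegral_nonneg measurableSet_Ioi
      fun x _ => gaussianPDFReal_nonneg _ _ _)]
  set K : ℝ := (√(2 * π * v))⁻¹ with hK
  have hK0 : 0 < K := by positivity
  have hd : ∀ x ∈ Set.Ici s, HasDerivAt (fun x => -(K * v / s) * exp (-x ^ 2 / (2 * v)))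
      (x / s * gaussianPDFReal 0 v x) x := by
    intro x _
    have h1 : HasDerivAt (fun x : ℝ => -x ^ 2 / (2 * v)) (-(2 * x) / (2 * v)) x := by
      have := ((hasDerivAt_pow 2 x).neg).div_const (2 * (v : ℝ))
      simpa using this
    have := (h1.exp).const_mul (-(K * (v : ℝ) / s))
    refine this.congr_deriv ?_
    simp only [gaussianPDFReal, sub_zero, ← hK]
    field_simp
  have hlim : Tendsto (fun x => -(K * v / s) * exp (-x ^ 2 / (2 * v))) atTop (𝓝 0) := by
    have h1 : Tendsto (fun x : ℝ => -x ^ 2 / (2 * v)) atTop atBot := by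
      have h2 : Tendsto (fun x : ℝ => x ^ 2 / (2 * v)) atTop atTop :=
        (tendsto_pow_atTop two_ne_zero).atTop_div_const (by positivity)
      refine (tendsto_neg_atTop_atBot.comp h2).congr fun x => ?_
      simp [neg_div]
    simpa using (tendsto_exp_atBot.comp h1).const_mul (-(K * v / s))
  have hnn : ∀ x ∈ Set.Ioi s, 0 ≤ x / s * gaussianPDFReal 0 v x := by
    intro x hx
    have := gaussianPDFReal_nonneg 0 v x
    have : 0 < x := hs.trans hx
    positivity
  have hintg := integrableOn_Ioi_deriv_of_nonneg' hd hnn hlim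
  have hval := integral_Ioi_of_hasDerivAt_of_nonneg' hd hnn hlim
  calc ∫ x in Set.Ioi s, gaussianPDFReal 0 v x
      ≤ ∫ x in Set.Ioi s, x / s * gaussianPDFReal 0 v x := by
        refine setIntegral_mono_on (integrable_gaussianPDFReal 0 v).integrableOn hintg
          measurableSet_Ioi fun x hx => ?_
        have h1 : 1 ≤ x / s := by rw [one_le_div hs]; exact (le_of_lt hx)
        have := gaussianPDFReal_nonneg 0 v x
        nlinarith
    _ = K * v / s * exp (-s ^ 2 / (2 * v)) := by rw [hval]; ring
    _ ≤ √v / s * exp (-s ^ 2 / (2 * v)) := by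
        gcongr
        rw [hK, inv_mul_le_iff₀ (by positivity), ← Real.sqrt_mul (by positivity)]
        refine Real.le_sqrt_of_sq_le ?_
        have : 3 < π := Real.pi_gt_three
        nlinarith [sq_nonneg (v : ℝ)]

/-! ### Indicator matrices and truncated likelihood ratios -/

lemma lin_smul {N : ℕ} (a : ℝ) (c x : Fin N → Fin N → ℝ) : lin (a • c) x = a * lin c x := by
  simp [lin, Finset.mul_sum, mul_assoc]

lemma lin_add {N : ℕ} (c d x : Fin N → Fin N → ℝ) : lin (c + d) x = lin c x + lin d x := by
  simp [lin, add_mul, Finset.sum_add_distrib]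

lemma lin_comm {N : ℕ} (c x : Fin N → Fin N → ℝ) : lin c x = lin x c := by
  simp only [lin]
  exact Finset.sum_congr rfl fun i _ => Finset.sum_congr rfl fun j _ => mul_comm _ _

/-- Indicator matrix of `R × C`. -/
def ind {N : ℕ} (R C : Finset (Fin N)) : Fin N → Fin N → ℝ :=
  fun i j => if i ∈ R ∧ j ∈ C then 1 else 0

lemma lin_ind {N : ℕ} (R C : Finset (Fin N)) (x : Fin N → Fin N → ℝ) :
    lin (ind R C) x = ∑ i ∈ R, ∑ j ∈ C, x i j := by
  simp [lin, ind, ite_and, Finset.sum_ite_mem]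

lemma lin_ind_ind {N : ℕ} (R C R' C' : Finset (Fin N)) :
    lin (ind R C) (ind R' C') = ((R ∩ R').card : ℝ) * (C ∩ C').card := by
  rw [lin_ind]
  simp [ind, ite_and, Finset.sum_ite_mem]

/-- One truncated likelihood ratio, as a function of the block sum. -/
def gfun (A : ℝ) (n : ℕ) (y : ℝ) : ℝ :=
  if y ≤ (n : ℝ) ^ 2 * A then exp (A * y - A ^ 2 * (n : ℝ) ^ 2 / 2) else 0

lemma gfun_meas (A : ℝ) (n : ℕ) : Measurable (gfun A n) := by
  unfold gfun
  exact Measurable.ite measurableSet_Iic (by fun_prop) measurable_const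

lemma gfun_nonneg (A : ℝ) (n : ℕ) (y : ℝ) : 0 ≤ gfun A n y := by
  unfold gfun; split_ifs <;> positivity

lemma gfun_le (A : ℝ) (hA : 0 ≤ A) (n : ℕ) (y : ℝ) :
    gfun A n y ≤ exp (A * ((n : ℝ) ^ 2 * A)) := by
  unfold gfun; split_ifs with h
  · apply exp_le_exp.2
    have := mul_le_mul_of_nonneg_left h hA
    have : 0 ≤ A ^ 2 * (n : ℝ) ^ 2 / 2 := by positivity
    linarith
  · positivity

/-- The error term of the second moment. -/
def hfun (A : ℝ) (n a b : ℕ) : ℝ :=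
  if a * b = 0 then 0 else
  if a = n ∧ b = n then exp (A ^ 2 * (n : ℝ) ^ 2 / 2) / (n * A) else
  exp (A ^ 2 * ((n : ℝ) ^ 2 * (a * b) / ((n : ℝ) ^ 2 + a * b)))

lemma hfun_nonneg (A : ℝ) (hA : 0 ≤ A) (n a b : ℕ) : 0 ≤ hfun A n a b := by
  unfold hfun; split_ifs <;> positivity

lemma lin_ind_self {N n : ℕ} {R C : Finset (Fin N)} (hR : R.card = n) (hC : C.card = n) :
    lin (ind R C) (ind R C) = (n : ℝ) ^ 2 := by
  rw [lin_ind_ind, Finset.inter_self, Finset.inter_self, hR, hC, sq]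

/-- Law of the block sum: lower tails. -/
lemma block_tail {N n : ℕ} {R C : Finset (Fin N)} (hR : R.card = n) (hC : C.card = n)
    (θ : Fin N → Fin N → ℝ) (s : ℝ) :
    (PTheta N θ).real {x | lin (ind R C) x ≤ s} =
      (gaussianReal 0 ((n : NNReal) ^ 2)).real (Set.Ici (lin (ind R C) θ - s)) := by
  rw [← gauss_reflect, ← lin_law θ (ind R C) _ (by rw [lin_ind_self hR hC]; simp),
    map_measureReal_apply (lin_meas _) measurableSet_Iic]
  rfl

lemma n_sq_ne {n : ℕ} (hn : 0 < n) : ((n : NNReal) ^ 2) ≠ 0 := by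
  have : (n : NNReal) ≠ 0 := by exact_mod_cast hn.ne'
  exact pow_ne_zero _ this

lemma mills_block {n : ℕ} (hn : 0 < n) {A : ℝ} (hA : 0 < A) :
    (gaussianReal 0 ((n : NNReal) ^ 2)).real (Set.Ici ((n : ℝ) ^ 2 * A)) ≤
      exp (-(A ^ 2 * (n : ℝ) ^ 2 / 2)) / (n * A) := by
  have hn' : (0 : ℝ) < n := by exact_mod_cast hn
  refine (gauss_mills _ (n_sq_ne hn) _ (by positivity)).trans_eq ?_
  have : (((n : NNReal) ^ 2 : NNReal) : ℝ) = (n : ℝ) ^ 2 := by simp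
  rw [this, Real.sqrt_sq hn'.le]
  have e : -((n : ℝ) ^ 2 * A) ^ 2 / (2 * (n : ℝ) ^ 2) = -(A ^ 2 * (n : ℝ) ^ 2 / 2) := by
    field_simp
  rw [e]
  field_simp

lemma integrable_of_bdd {N : ℕ} (f : (Fin N → Fin N → ℝ) → ℝ) (hf : Measurable f) (K : ℝ)
    (h0 : ∀ x, 0 ≤ f x) (hK : ∀ x, f x ≤ K) : Integrable f (PTheta N 0) :=
  Integrable.of_bound hf.aestronglyMeasurable K
    (ae_of_all _ fun x => by rw [Real.norm_eq_abs, abs_of_nonneg (h0 x)]; exact hK x)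

lemma gfun_eq_indicator {N n : ℕ} {R C : Finset (Fin N)} (hR : R.card = n) (hC : C.card = n)
    (A : ℝ) (x : Fin N → Fin N → ℝ) : gfun A n (lin (ind R C) x) =
      {x | lin (ind R C) x ≤ (n : ℝ) ^ 2 * A}.indicator
        (fun x => exp (lin (A • ind R C) x - lin (A • ind R C) (A • ind R C) / 2)) x := by
  simp only [gfun, Set.indicator, Set.mem_ofPred_eq]
  congr 2
  rw [lin_smul, lin_smul, lin_comm _ (A • _), lin_smul, lin_ind_self hR hC]
  ring

lemma integral_gfun {N n : ℕ} (hn : 0 < n) {R C : Finset (Fin N)} (hR : R.card = n)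
    (hC : C.card = n) (A : ℝ) :
    ∫ x, gfun A n (lin (ind R C) x) ∂(PTheta N 0) = 1 / 2 := by
  simp_rw [gfun_eq_indicator hR hC]
  rw [← PTheta_real _ (measurableSet_le (lin_meas _) measurable_const), block_tail hR hC,
    lin_comm, lin_smul, lin_ind_self hR hC, mul_comm A, sub_self, gauss_half _ (n_sq_ne hn)]

lemma setIntegral_gfun_le {N n : ℕ} {R C : Finset (Fin N)} (hR : R.card = n)
    (hC : C.card = n) {A : ℝ} (hA : 0 ≤ A) {T : Set (Fin N → Fin N → ℝ)} (hT : MeasurableSet T) :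
    ∫ x in T, gfun A n (lin (ind R C) x) ∂(PTheta N 0) ≤ (PTheta N (A • ind R C)).real T := by
  rw [PTheta_real _ hT, integral_indicator hT]
  have hm := lin_meas (A • ind R C)
  have hi : Integrable (fun x => exp (lin (A • ind R C) x -
      lin (A • ind R C) (A • ind R C) / 2)) (PTheta N 0) := by
    simp_rw [exp_sub]
    exact (integrable_exp_lin _).div_const _
  refine integral_mono ?_ hi.integrableOn fun x => ?_
  · exact (integrable_of_bdd _ ((gfun_meas A n).comp (lin_meas _)) _ (fun x => gfun_nonneg _ _ _)
      (fun x => gfun_le A hA n _)).integrableOn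
  · dsimp only
    rw [gfun_eq_indicator hR hC]
    exact Set.indicator_le_self' (fun _ _ => (exp_pos _).le) x

lemma integral_gfun_mul {N n : ℕ} (hn : 0 < n) {R C R' C' : Finset (Fin N)} (hR : R.card = n)
    (hC : C.card = n) (hR' : R'.card = n) (hC' : C'.card = n) {A : ℝ} (hA : 0 < A) :
    ∫ x, gfun A n (lin (ind R C) x) * gfun A n (lin (ind R' C') x) ∂(PTheta N 0) ≤
      1 / 4 + hfun A n (R ∩ R').card (C ∩ C').card := by
  have hn' : (0 : ℝ) < n := by exact_mod_cast hn
  unfold hfun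
  split_ifs with h1 h2
  · -- disjoint blocks
    have hind : IndepFun (lin (ind R C)) (lin (ind R' C')) (PTheta N 0) := by
      refine lin_indep _ _ fun i j => ?_
      by_contra hcon
      push Not at hcon
      simp only [ind, ne_eq, ite_eq_right_iff, one_ne_zero, imp_false, not_not] at hcon
      rcases Nat.mul_eq_zero.1 h1 with h | h
      · rw [Finset.card_eq_zero] at h
        exact Finset.notMem_empty i (h ▸ Finset.mem_inter.2 ⟨hcon.1.1, hcon.2.1⟩)
      · rw [Finset.card_eq_zero] at h
        exact Finset.notMem_empty j (h ▸ Finset.mem_inter.2 ⟨hcon.1.2, hcon.2.2⟩)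
    have := (hind.comp (gfun_meas A n) (gfun_meas A n)).integral_fun_mul_eq_mul_integral
      ((gfun_meas A n).comp (lin_meas _)).aestronglyMeasurable
      ((gfun_meas A n).comp (lin_meas _)).aestronglyMeasurable
    simp only [Function.comp_apply] at this
    rw [this, integral_gfun hn hR hC, integral_gfun hn hR' hC']
    norm_num
  · -- identical blocks
    have e1 : R = R' := by
      have a1 : R ∩ R' = R := Finset.eq_of_subset_of_card_le Finset.inter_subset_left (by omega)
      have a2 : R ∩ R' = R' := Finset.eq_of_subset_of_card_le Finset.inter_subset_right (by omega)
      exact a1.symm.trans a2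
    have e2 : C = C' := by
      have a1 : C ∩ C' = C := Finset.eq_of_subset_of_card_le Finset.inter_subset_left (by omega)
      have a2 : C ∩ C' = C' := Finset.eq_of_subset_of_card_le Finset.inter_subset_right (by omega)
      exact a1.symm.trans a2
    subst e1 e2
    have key : ∀ x, gfun A n (lin (ind R C) x) * gfun A n (lin (ind R C) x) =
        exp (A ^ 2 * (n : ℝ) ^ 2) * {x | lin (ind R C) x ≤ (n : ℝ) ^ 2 * A}.indicator
        (fun x => exp (lin ((2 * A) • ind R C) x -
          lin ((2 * A) • ind R C) ((2 * A) • ind R C) / 2)) x := by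
      intro x
      simp only [gfun, Set.indicator, Set.mem_ofPred_eq]
      split_ifs
      · rw [← exp_add, ← exp_add]
        congr 1
        rw [lin_smul, lin_smul, lin_comm _ ((2 * A) • _), lin_smul, lin_ind_self hR hC]
        ring
      · simp
    simp_rw [key]
    rw [integral_const_mul, ← PTheta_real _ (measurableSet_le (lin_meas _) measurable_const),
      block_tail hR hC, lin_comm, lin_smul, lin_ind_self hR hC]
    have e : 2 * A * (n : ℝ) ^ 2 - (n : ℝ) ^ 2 * A = (n : ℝ) ^ 2 * A := by ring
    rw [e]
    have := mul_le_mul_of_nonneg_left (mills_block hn hA) (exp_pos (A ^ 2 * (n : ℝ) ^ 2)).le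
    rw [← mul_div_assoc, ← exp_add] at this
    have e' : A ^ 2 * (n : ℝ) ^ 2 + -(A ^ 2 * (n : ℝ) ^ 2 / 2) = A ^ 2 * (n : ℝ) ^ 2 / 2 := by ring
    rw [e'] at this
    linarith
  · -- partial overlap
    set k : ℝ := ((R ∩ R').card : ℝ) * (C ∩ C').card with hk
    have hk0 : 0 ≤ k := by positivity
    set μ : ℝ := A * ((n : ℝ) ^ 2 / ((n : ℝ) ^ 2 + k)) with hμ
    set lam : ℝ := A * (k / ((n : ℝ) ^ 2 + k)) with hlam
    have hlam0 : 0 ≤ lam := by positivity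
    have hsum : μ + lam = A := by
      rw [hμ, hlam]; field_simp
    have hbd : ∀ x, gfun A n (lin (ind R C) x) * gfun A n (lin (ind R' C') x) ≤
        exp (2 * lam * ((n : ℝ) ^ 2 * A) - A ^ 2 * (n : ℝ) ^ 2) *
          exp (lin (μ • (ind R C + ind R' C')) x) := by
      intro x
      unfold gfun
      split_ifs with h3 h4
      · rw [← exp_add, ← exp_add]
        apply exp_le_exp.2
        rw [lin_smul, lin_add]
        have hμ' : μ = A - lam := by linarith
        rw [hμ']
        have i3 := mul_le_mul_of_nonneg_left h3 hlam0
        have i4 := mul_le_mul_of_nonneg_left h4 hlam0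
        linarith
      all_goals simp; try positivity
    have hi := (integrable_exp_lin (μ • (ind R C + ind R' C'))).const_mul
      (exp (2 * lam * ((n : ℝ) ^ 2 * A) - A ^ 2 * (n : ℝ) ^ 2))
    have h5 := integral_mono_of_nonneg (ae_of_all _ fun x => mul_nonneg (gfun_nonneg A n _)
      (gfun_nonneg A n _)) hi (ae_of_all _ hbd)
    rw [integral_const_mul, integral_exp_lin, ← exp_add] at h5
    have h6 : lin (μ • (ind R C + ind R' C')) (μ • (ind R C + ind R' C'))
        = μ ^ 2 * (2 * ((n : ℝ) ^ 2 + k)) := by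
      rw [lin_smul, lin_comm, lin_smul, lin_add, lin_comm (ind R C), lin_comm (ind R' C'),
        lin_add, lin_add, lin_ind_self hR hC, lin_ind_self hR' hC', lin_comm (ind R' C') (ind R C),
        lin_ind_ind, ← hk]
      ring
    rw [h6] at h5
    have h7 : 2 * lam * ((n : ℝ) ^ 2 * A) - A ^ 2 * (n : ℝ) ^ 2 +
        μ ^ 2 * (2 * ((n : ℝ) ^ 2 + k)) / 2 = A ^ 2 * ((n : ℝ) ^ 2 * k / ((n : ℝ) ^ 2 + k)) := by
      rw [hlam, hμ]
      field_simp
      ring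
    rw [h7] at h5
    linarith

/-! ### Counting -/

/-- All `n`-subsets of `Fin N`. -/
def subs (n N : ℕ) : Finset (Finset (Fin N)) := Finset.powersetCard n Finset.univ

lemma mem_subs {n N : ℕ} {R : Finset (Fin N)} : R ∈ subs n N ↔ R.card = n := by
  simp [subs]

lemma card_subs (n N : ℕ) : (subs n N).card = N.choose n := by
  simp [subs]

lemma count_overlap {n N : ℕ} {R : Finset (Fin N)} (hR : R.card = n) (a : ℕ) :
    ((subs n N).filter fun R' => (R ∩ R').card = a).card ≤ 2 ^ n * N ^ (n - a) := by
  have h : ((subs n N).filter fun R' => (R ∩ R').card = a).card ≤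
      (R.powerset ×ˢ Finset.powersetCard (n - a) (Finset.univ : Finset (Fin N))).card := by
    refine Finset.card_le_card_of_injOn (fun R' => (R ∩ R', R' \ R)) ?_ ?_
    · intro R' h
      simp only [Finset.coe_filter, Set.mem_ofPred_eq, mem_subs] at h
      simp only [Finset.coe_product, Set.mem_prod, Finset.mem_coe, Finset.mem_powerset,
        Finset.mem_powersetCard, Finset.subset_univ, true_and]
      refine ⟨Finset.inter_subset_left, ?_⟩
      have := Finset.card_sdiff_add_card_inter R' R
      rw [Finset.inter_comm R' R] at this
      omega
    · intro x _ y _ hxy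
      simp only [Prod.mk.injEq] at hxy
      have hx := Finset.sdiff_union_inter x R
      have hy := Finset.sdiff_union_inter y R
      rw [← hx, ← hy, hxy.2, Finset.inter_comm x, hxy.1, Finset.inter_comm y]
  refine h.trans ?_
  rw [Finset.card_product, Finset.card_powerset, Finset.card_powersetCard, hR, Finset.card_univ,
    Fintype.card_fin]
  exact Nat.mul_le_mul_left _ (Nat.choose_le_pow _ _)

lemma sum_overlap_le {n N : ℕ} {R : Finset (Fin N)} (hR : R.card = n) (F : ℕ → ℝ)
    (hF : ∀ a, 0 ≤ F a) : ∑ R' ∈ subs n N, F (R ∩ R').card ≤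
      ∑ a ∈ Finset.range (n + 1), (2 ^ n * (N : ℝ) ^ (n - a)) * F a := by
  have hmap : ∀ R' ∈ subs n N, (R ∩ R').card ∈ Finset.range (n + 1) := by
    intro R' _
    have := Finset.card_le_card (Finset.inter_subset_left (s₁ := R) (s₂ := R'))
    simp; omega
  rw [← Finset.sum_fiberwise_of_maps_to hmap]
  refine Finset.sum_le_sum fun a _ => ?_
  have : ∀ R' ∈ (subs n N).filter (fun R' => (R ∩ R').card = a), F (R ∩ R').card = F a := by
    intro R' h
    rw [(Finset.mem_filter.1 h).2]
  rw [Finset.sum_congr rfl this, Finset.sum_const, nsmul_eq_mul]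
  refine mul_le_mul_of_nonneg_right ?_ (hF a)
  exact_mod_cast count_overlap hR a

/-- The total error bound. -/
def Bfun (A : ℝ) (n N : ℕ) : ℝ :=
  ∑ a ∈ Finset.range (n + 1), (2 ^ n * (N : ℝ) ^ (n - a)) *
    ∑ b ∈ Finset.range (n + 1), (2 ^ n * (N : ℝ) ^ (n - b)) * hfun A n a b

lemma sum_hfun_le {n N : ℕ} {A : ℝ} (hA : 0 ≤ A) {R C : Finset (Fin N)} (hR : R.card = n)
    (hC : C.card = n) :
    ∑ q ∈ subs n N ×ˢ subs n N, hfun A n (R ∩ q.1).card (C ∩ q.2).card ≤ Bfun A n N := by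
  rw [Finset.sum_product]
  calc ∑ R' ∈ subs n N, ∑ C' ∈ subs n N, hfun A n (R ∩ R').card (C ∩ C').card
      ≤ ∑ R' ∈ subs n N, ∑ b ∈ Finset.range (n + 1), (2 ^ n * (N : ℝ) ^ (n - b)) *
          hfun A n (R ∩ R').card b :=
        Finset.sum_le_sum fun R' _ => sum_overlap_le hC (fun b => hfun A n (R ∩ R').card b)
          (fun b => hfun_nonneg A hA _ _ _)
    _ ≤ _ := sum_overlap_le hR (fun a => ∑ b ∈ Finset.range (n + 1),
        (2 ^ n * (N : ℝ) ^ (n - b)) * hfun A n a b)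
          (fun a => Finset.sum_nonneg fun b _ => mul_nonneg (by positivity)
            (hfun_nonneg A hA _ _ _))

/-! ### Lower bound -/

lemma bdd_risk {n N : ℕ} (A : ℝ) (T : Set (Fin N → Fin N → ℝ)) :
    BddAbove (Set.range fun θ : ThetaSet A n N => (PTheta N θ.1 T).toReal) := by
  refine ⟨1, ?_⟩
  rintro _ ⟨θ, rfl⟩
  exact measureReal_le_one

lemma testRisk_lower {n N : ℕ} (hn : 0 < n) (hN : n ≤ N) {A : ℝ} (hA : 0 < A)
    {T : Set (Fin N → Fin N → ℝ)} (hT : MeasurableSet T) :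
    1 / 2 - 1 / 2 * (Bfun A n N / (N.choose n : ℝ) ^ 2) ≤ testRisk n N A T := by
  set W := subs n N ×ˢ subs n N with hW
  set w : ℝ := (N.choose n : ℝ) ^ 2 with hw
  have hwc : (W.card : ℝ) = w := by
    rw [hW, Finset.card_product, card_subs, hw]; push_cast; ring
  have hw0 : 0 < w := by
    have : 0 < N.choose n := Nat.choose_pos hN
    positivity
  have hmem : ∀ p ∈ W, p.1.card = n ∧ p.2.card = n := by
    intro p hp
    rw [hW, Finset.mem_product, mem_subs, mem_subs] at hp
    exact hp
  set g : Finset (Fin N) × Finset (Fin N) → (Fin N → Fin N → ℝ) → ℝ :=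
    fun p x => gfun A n (lin (ind p.1 p.2) x) with hg
  have hgm : ∀ p, Measurable (g p) := fun p => (gfun_meas A n).comp (lin_meas _)
  have hgi : ∀ p, Integrable (g p) (PTheta N 0) := fun p =>
    integrable_of_bdd _ (hgm p) _ (fun x => gfun_nonneg _ _ _) (fun x => gfun_le A hA.le n _)
  have hggi : ∀ p q, Integrable (fun x => g p x * g q x) (PTheta N 0) := fun p q =>
    integrable_of_bdd _ ((hgm p).mul (hgm q))
      (exp (A * ((n : ℝ) ^ 2 * A)) * exp (A * ((n : ℝ) ^ 2 * A)))
      (fun x => mul_nonneg (gfun_nonneg _ _ _) (gfun_nonneg _ _ _))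
      (fun x => mul_le_mul (gfun_le A hA.le n _) (gfun_le A hA.le n _) (gfun_nonneg _ _ _)
        (exp_pos _).le)
  set L : (Fin N → Fin N → ℝ) → ℝ := fun x => w⁻¹ * ∑ p ∈ W, g p x with hL
  have hLi : Integrable L (PTheta N 0) :=
    (integrable_finsetSum _ fun p _ => hgi p).const_mul _
  have hL2e : ∀ x, L x ^ 2 = w⁻¹ ^ 2 * ∑ p ∈ W, ∑ q ∈ W, g p x * g q x := by
    intro x
    rw [hL]; dsimp only
    rw [mul_pow, sq (∑ p ∈ W, g p x), Finset.sum_mul_sum]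
  have hL2i : Integrable (fun x => L x ^ 2) (PTheta N 0) := by
    simp_rw [hL2e]
    exact (integrable_finsetSum _ fun p _ => integrable_finsetSum _ fun q _ =>
      hggi p q).const_mul _
  have hLint : ∫ x, L x ∂(PTheta N 0) = 1 / 2 := by
    rw [hL]
    rw [integral_const_mul, integral_finsetSum _ fun p _ => hgi p,
      Finset.sum_congr rfl fun p hp => integral_gfun hn (hmem p hp).1 (hmem p hp).2 A,
      Finset.sum_const, nsmul_eq_mul, hwc]
    field_simp
  have hL2int : ∫ x, L x ^ 2 ∂(PTheta N 0) ≤ 1 / 4 + Bfun A n N / w := by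
    simp_rw [hL2e]
    rw [integral_const_mul, integral_finsetSum _ fun p _ => integrable_finsetSum _ fun q _ =>
      hggi p q]
    have h1 : ∀ p ∈ W, ∫ x, ∑ q ∈ W, g p x * g q x ∂(PTheta N 0) ≤ w * (1 / 4) + Bfun A n N := by
      intro p hp
      rw [integral_finsetSum _ fun q _ => hggi p q]
      calc ∑ q ∈ W, ∫ x, g p x * g q x ∂(PTheta N 0)
          ≤ ∑ q ∈ W, (1 / 4 + hfun A n (p.1 ∩ q.1).card (p.2 ∩ q.2).card) :=
            Finset.sum_le_sum fun q hq => integral_gfun_mul hn (hmem p hp).1 (hmem p hp).2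
              (hmem q hq).1 (hmem q hq).2 hA
        _ ≤ _ := by
            rw [Finset.sum_add_distrib, Finset.sum_const, nsmul_eq_mul, hwc]
            gcongr
            exact sum_hfun_le hA.le (hmem p hp).1 (hmem p hp).2
    calc w⁻¹ ^ 2 * ∑ p ∈ W, ∫ x, ∑ q ∈ W, g p x * g q x ∂(PTheta N 0)
        ≤ w⁻¹ ^ 2 * ∑ p ∈ W, (w * (1 / 4) + Bfun A n N) := by
          gcongr with p hp
          exact h1 p hp
      _ = _ := by
          rw [Finset.sum_const, nsmul_eq_mul, hwc]
          field_simp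
  -- average type II error
  have hII : ∫ x in Tᶜ, L x ∂(PTheta N 0) ≤
      ⨆ θ : ThetaSet A n N, (PTheta N θ.1 Tᶜ).toReal := by
    rw [hL]
    rw [integral_const_mul, integral_finsetSum _ fun p _ => (hgi p).integrableOn]
    calc w⁻¹ * ∑ p ∈ W, ∫ x in Tᶜ, g p x ∂(PTheta N 0)
        ≤ w⁻¹ * ∑ p ∈ W, ⨆ θ : ThetaSet A n N, (PTheta N θ.1 Tᶜ).toReal := by
          gcongr with p hp
          refine (setIntegral_gfun_le (hmem p hp).1 (hmem p hp).2 hA.le hT.compl).trans ?_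
          refine le_ciSup (bdd_risk (n := n) A Tᶜ) ⟨A • ind p.1 p.2, p.1, p.2, (hmem p hp).1,
            (hmem p hp).2, ?_, ?_⟩
          · intro i j hi hj
            simp [ind, hi, hj]
          · intro i j hij
            simp [ind, hij]
      _ = _ := by
          rw [Finset.sum_const, nsmul_eq_mul, hwc]
          field_simp
  have hI : ∫ x in T, (1 : ℝ) ∂(PTheta N 0) = (PTheta N 0 T).toReal := by
    simp [measureReal_def]
  have hQi : Integrable (fun x => 3 / 2 * L x - 1 / 2 * L x ^ 2 - 1 / 8) (PTheta N 0) :=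
    ((hLi.const_mul _).sub (hL2i.const_mul _)).sub (integrable_const _)
  have hQ : ∫ x, (3 / 2 * L x - 1 / 2 * L x ^ 2 - 1 / 8) ∂(PTheta N 0) ≤ testRisk n N A T := by
    rw [← integral_add_compl hT hQi]
    unfold testRisk
    refine add_le_add ?_ ?_
    · rw [← hI]
      refine integral_mono hQi.integrableOn (integrable_const _) fun x => ?_
      dsimp only
      nlinarith [sq_nonneg (L x - 3 / 2)]
    · refine le_trans ?_ hII
      refine integral_mono hQi.integrableOn hLi.integrableOn fun x => ?_
      dsimp only
      nlinarith [sq_nonneg (L x - 1 / 2)]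
  have hdi : Integrable (fun x => 3 / 2 * L x - 1 / 2 * L x ^ 2) (PTheta N 0) :=
    (hLi.const_mul _).sub (hL2i.const_mul _)
  rw [integral_sub hdi (integrable_const _),
    integral_sub (hLi.const_mul _) (hL2i.const_mul _), integral_const_mul (3 / 2) L,
    integral_const_mul (1 / 2) (fun x => L x ^ 2), hLint] at hQ
  simp only [integral_const, probReal_univ, smul_eq_mul, one_mul] at hQ
  linarith

/-! ### Upper bound -/

lemma minimax_upper {n N : ℕ} (hn : 0 < n) {A : ℝ} (hA : 0 < A) :
    minimaxRisk n N A ≤ (N : ℝ) ^ (2 * n) * (exp (-(A ^ 2 * (n : ℝ) ^ 2 / 2)) / (n * A))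
      + 1 / 2 := by
  set W := subs n N ×ˢ subs n N with hW
  have hmem : ∀ p ∈ W, p.1.card = n ∧ p.2.card = n := by
    intro p hp
    rw [hW, Finset.mem_product, mem_subs, mem_subs] at hp
    exact hp
  set D : Finset (Fin N) × Finset (Fin N) → Set (Fin N → Fin N → ℝ) :=
    fun p => {x | lin (ind p.1 p.2) x ≤ (n : ℝ) ^ 2 * A} with hD
  have hDm : ∀ p, MeasurableSet (D p) := fun p => measurableSet_le (lin_meas _) measurable_const
  set T : Set (Fin N → Fin N → ℝ) := ⋃ p ∈ W, (D p)ᶜ with hTdef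
  have hT : MeasurableSet T := Finset.measurableSet_biUnion _ fun p _ => (hDm p).compl
  have hbelow : BddBelow (Set.range fun T : {T : Set (Fin N → Fin N → ℝ) // MeasurableSet T} =>
      testRisk n N A T.1) := by
    refine ⟨0, ?_⟩
    rintro _ ⟨T, rfl⟩
    exact add_nonneg ENNReal.toReal_nonneg (Real.iSup_nonneg fun _ => ENNReal.toReal_nonneg)
  refine (ciInf_le hbelow ⟨T, hT⟩).trans ?_
  unfold testRisk
  refine add_le_add ?_ ?_
  · have h1 : ∀ p ∈ W, (PTheta N 0).real (D p)ᶜ ≤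
        exp (-(A ^ 2 * (n : ℝ) ^ 2 / 2)) / (n * A) := by
      intro p hp
      obtain ⟨hR, hC⟩ := hmem p hp
      refine le_trans ?_ (mills_block hn hA)
      have hlaw := lin_law 0 (ind p.1 p.2) ((n : NNReal) ^ 2) (by rw [lin_ind_self hR hC]; simp)
      have h0 : lin (ind p.1 p.2) 0 = 0 := by simp [lin]
      rw [h0] at hlaw
      rw [← hlaw, map_measureReal_apply (lin_meas _) measurableSet_Ici]
      refine measureReal_mono fun x hx => ?_
      simp only [hD, Set.mem_compl_iff, Set.mem_ofPred_eq, not_le] at hx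
      exact hx.le
    calc (PTheta N 0 T).toReal ≤ ∑ p ∈ W, (PTheta N 0).real (D p)ᶜ :=
          measureReal_biUnion_finset_le _ _
      _ ≤ ∑ p ∈ W, exp (-(A ^ 2 * (n : ℝ) ^ 2 / 2)) / (n * A) := Finset.sum_le_sum h1
      _ ≤ _ := by
          rw [Finset.sum_const, nsmul_eq_mul]
          refine mul_le_mul_of_nonneg_right ?_ (by positivity)
          rw [hW, Finset.card_product, card_subs, two_mul, pow_add]
          have := Nat.choose_le_pow N n
          exact_mod_cast Nat.mul_le_mul this this
  · refine Real.iSup_le (fun θ => ?_) (by norm_num)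
    obtain ⟨θ, R, C, hR, hC, h1, h2⟩ := θ
    have hsub : Tᶜ ⊆ {x | lin (ind R C) x ≤ (n : ℝ) ^ 2 * A} := by
      intro x hx
      by_contra hcon
      apply hx
      rw [hTdef]
      refine Set.mem_biUnion (x := (R, C)) ?_ hcon
      simp [hW, mem_subs, hR, hC]
    have hmean : (n : ℝ) ^ 2 * A ≤ lin (ind R C) θ := by
      rw [lin_ind]
      calc (n : ℝ) ^ 2 * A = ∑ i ∈ R, ∑ j ∈ C, A := by simp [hR, hC]; ring
        _ ≤ _ := Finset.sum_le_sum fun i hi => Finset.sum_le_sum fun j hj => h1 i j hi hj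
    calc (PTheta N θ Tᶜ).toReal ≤ (PTheta N θ).real {x | lin (ind R C) x ≤ (n : ℝ) ^ 2 * A} :=
          measureReal_mono hsub
      _ ≤ 1 / 2 := by
          rw [block_tail hR hC, ← gauss_half _ (n_sq_ne hn)]
          exact measureReal_mono (Set.Ici_subset_Ici.2 (by linarith))

/-! ### Asymptotics -/

lemma choose_lower {n N : ℕ} (hN : 2 * n ≤ N) :
    (N : ℝ) ^ n ≤ 2 ^ n * n.factorial * (N.choose n : ℝ) := by
  have h := Nat.pow_le_choose (α := ℝ) n N
  rw [div_le_iff₀ (by positivity)] at h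
  have h1 : (N : ℝ) ≤ 2 * ((N + 1 - n : ℕ) : ℝ) := by
    have : N ≤ 2 * (N + 1 - n) := by omega
    exact_mod_cast this
  calc (N : ℝ) ^ n ≤ (2 * ((N + 1 - n : ℕ) : ℝ)) ^ n := by gcongr
    _ = 2 ^ n * ((N + 1 - n : ℕ) : ℝ) ^ n := mul_pow _ _ _
    _ ≤ 2 ^ n * ((N.choose n : ℝ) * n.factorial) := by
        gcongr
    _ = _ := by ring

lemma Bfun_le {n N : ℕ} (hn : 0 < n) (hN : 2 * n ≤ N) {A : ℝ} (hA : 0 ≤ A) :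
    Bfun A n N / (N.choose n : ℝ) ^ 2 ≤
      ∑ a ∈ Finset.range (n + 1), ∑ b ∈ Finset.range (n + 1),
        (2 ^ n * (2 ^ n * (n.factorial : ℝ))) ^ 2 * (hfun A n a b / (N : ℝ) ^ (a + b)) := by
  have hM : (0 : ℝ) < N.choose n := by exact_mod_cast Nat.choose_pos (by omega)
  have hN0 : (0 : ℝ) < N := by
    have : 0 < N := by omega
    exact_mod_cast this
  have key : ∀ a ∈ Finset.range (n + 1), 2 ^ n * (N : ℝ) ^ (n - a) / (N.choose n : ℝ) ≤
      2 ^ n * (2 ^ n * (n.factorial : ℝ)) / (N : ℝ) ^ a := by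
    intro a ha
    have ha' : a ≤ n := by simp at ha; omega
    rw [div_le_div_iff₀ hM (by positivity), mul_assoc, ← pow_add, Nat.sub_add_cancel ha', mul_assoc]
    gcongr
    exact choose_lower hN
  unfold Bfun
  rw [Finset.sum_div]
  refine Finset.sum_le_sum fun a ha => ?_
  rw [Finset.mul_sum, Finset.sum_div]
  refine Finset.sum_le_sum fun b hb => ?_
  have hh := hfun_nonneg A hA n a b
  calc 2 ^ n * (N : ℝ) ^ (n - a) * (2 ^ n * (N : ℝ) ^ (n - b) * hfun A n a b) /
        (N.choose n : ℝ) ^ 2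
      = (2 ^ n * (N : ℝ) ^ (n - a) / (N.choose n : ℝ)) *
        (2 ^ n * (N : ℝ) ^ (n - b) / (N.choose n : ℝ)) * hfun A n a b := by
        field_simp
    _ ≤ (2 ^ n * (2 ^ n * (n.factorial : ℝ)) / (N : ℝ) ^ a) *
        (2 ^ n * (2 ^ n * (n.factorial : ℝ)) / (N : ℝ) ^ b) * hfun A n a b := by
        refine mul_le_mul_of_nonneg_right ?_ hh
        exact mul_le_mul (key a ha) (key b hb) (by positivity) (by positivity)
    _ = _ := by
        rw [pow_add]
        field_simp

/-- The critical amplitude. -/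
def crit (n N : ℕ) : ℝ := Real.sqrt (4 * Real.log N / n)

lemma crit_sq {n N : ℕ} (hN : 1 ≤ N) : crit n N ^ 2 = 4 * Real.log N / n := by
  unfold crit
  rw [Real.sq_sqrt]
  have : 0 ≤ Real.log N := Real.log_nonneg (by exact_mod_cast hN)
  positivity

lemma crit_pos {n N : ℕ} (hn : 0 < n) (hN : 2 ≤ N) : 0 < crit n N := by
  unfold crit
  apply Real.sqrt_pos.2
  have : 0 < Real.log N := Real.log_pos (by exact_mod_cast hN)
  positivity

lemma tendsto_log_nat : Tendsto (fun N : ℕ => Real.log N) atTop atTop :=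
  Real.tendsto_log_atTop.comp tendsto_natCast_atTop_atTop

lemma crit_tendsto {n : ℕ} (hn : 0 < n) :
    Tendsto (fun N : ℕ => 1 / ((n : ℝ) * crit n N)) atTop (𝓝 0) := by
  have hn' : (0 : ℝ) < n := by exact_mod_cast hn
  have h1 : Tendsto (fun N : ℕ => crit n N) atTop atTop := by
    unfold crit
    refine Real.tendsto_sqrt_atTop.comp ?_
    exact (tendsto_log_nat.const_mul_atTop (by norm_num)).atTop_div_const hn'
  exact tendsto_const_nhds.div_atTop (h1.const_mul_atTop hn')

lemma exp_crit {n N : ℕ} (hn : 0 < n) (hN : 1 ≤ N) :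
    exp (crit n N ^ 2 * (n : ℝ) ^ 2 / 2) = (N : ℝ) ^ (2 * n) := by
  have hn' : (0 : ℝ) < n := by exact_mod_cast hn
  have hN0 : (0 : ℝ) < N := by exact_mod_cast hN
  rw [crit_sq hN, ← Real.exp_log (pow_pos hN0 (2 * n)), Real.log_pow]
  congr 1
  push_cast
  field_simp
  ring

lemma exponent_gap {n a b : ℕ} (hn : 0 < n) (ha : a ≤ n) (hb : b ≤ n) (hab : a * b ≠ 0)
    (hne : ¬ (a = n ∧ b = n)) :
    4 * n * (a * b) / ((n : ℝ) ^ 2 + a * b) < a + b := by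
  have hn' : (0 : ℝ) < n := by exact_mod_cast hn
  have ha0 : (0 : ℝ) < a := by
    have : 0 < a := Nat.pos_of_ne_zero (by rintro rfl; simp at hab)
    exact_mod_cast this
  have hb0 : (0 : ℝ) < b := by
    have : 0 < b := Nat.pos_of_ne_zero (by rintro rfl; simp at hab)
    exact_mod_cast this
  have hlt : (a : ℝ) * b < (n : ℝ) ^ 2 := by
    have : a * b < n ^ 2 := by
      rw [sq]
      by_cases h : a = n
      · have : b < n := lt_of_le_of_ne hb fun h' => hne ⟨h, h'⟩
        subst h
        exact Nat.mul_lt_mul_of_pos_left this hn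
      · exact Nat.mul_lt_mul_of_lt_of_le (lt_of_le_of_ne ha h) hb hn
    exact_mod_cast this
  rw [div_lt_iff₀ (by positivity)]
  refine lt_of_pow_lt_pow_left₀ 2 (by positivity) ?_
  set k : ℝ := (a : ℝ) * b with hk
  have hk0 : 0 < k := by positivity
  have h1 : 4 * k ≤ ((a : ℝ) + b) ^ 2 := by nlinarith [sq_nonneg ((a : ℝ) - b)]
  have h2 : 4 * (n : ℝ) ^ 2 * k < ((n : ℝ) ^ 2 + k) ^ 2 := by
    nlinarith [mul_pos (sub_pos.2 hlt) (sub_pos.2 hlt)]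
  calc (4 * (n : ℝ) * k) ^ 2 = (4 * k) * (4 * (n : ℝ) ^ 2 * k) := by ring
    _ < (4 * k) * ((n : ℝ) ^ 2 + k) ^ 2 := by gcongr
    _ ≤ ((a : ℝ) + b) ^ 2 * ((n : ℝ) ^ 2 + k) ^ 2 := by gcongr
    _ = _ := by ring

lemma term_tendsto {n a b : ℕ} (hn : 0 < n) (ha : a ≤ n) (hb : b ≤ n) :
    Tendsto (fun N : ℕ => hfun (crit n N) n a b / (N : ℝ) ^ (a + b)) atTop (𝓝 0) := by
  have hn' : (0 : ℝ) < n := by exact_mod_cast hn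
  by_cases h1 : a * b = 0
  · simp [hfun, h1]
  by_cases h2 : a = n ∧ b = n
  · obtain ⟨rfl, rfl⟩ := h2
    refine (crit_tendsto hn).congr' ?_
    filter_upwards [eventually_ge_atTop 2] with N hN
    have hN0 : (0 : ℝ) < N := by
      have : 0 < N := by omega
      exact_mod_cast this
    have := crit_pos hn hN
    simp only [hfun, h1, if_false, and_self, if_true]
    rw [exp_crit hn (by omega), ← two_mul]
    field_simp
  · have hgap := exponent_gap hn ha hb h1 h2
    set e : ℝ := 4 * n * (a * b) / ((n : ℝ) ^ 2 + a * b) with he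
    have hl : Tendsto (fun N : ℕ => (e - (a + b)) * Real.log N) atTop atBot :=
      tendsto_log_nat.const_mul_atTop_of_neg (by linarith)
    refine (Real.tendsto_exp_atBot.comp hl).congr' ?_
    filter_upwards [eventually_ge_atTop 2] with N hN
    have hN0 : (0 : ℝ) < N := by
      have : 0 < N := by omega
      exact_mod_cast this
    simp only [hfun, h1, h2, if_false, Function.comp_apply]
    rw [crit_sq (by omega), ← Real.exp_log (pow_pos hN0 (a + b)), Real.log_pow, ← Real.exp_sub]
    congr 1
    rw [he]
    push_cast
    field_simp

/-- **Fixed-size critical limit.**  Fix a positive integer n.  With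
`A_N = √(4 log N / n)`, the minimax risk over all tests for detecting an n×n planted
submatrix in an N×N Gaussian matrix converges to 1/2 as N → ∞. -/
theorem critical_fixed_size (n : ℕ) (hn : 0 < n) :
    Tendsto (fun N : ℕ => minimaxRisk n N (Real.sqrt (4 * Real.log N / n)))
      atTop (𝓝 (1 / 2)) := by
  change Tendsto (fun N : ℕ => minimaxRisk n N (crit n N)) atTop (𝓝 (1 / 2))
  have hup : Tendsto (fun N : ℕ => 1 / ((n : ℝ) * crit n N) + 1 / 2) atTop (𝓝 (1 / 2)) := by
    simpa using (crit_tendsto hn).add_const (1 / 2 : ℝ)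
  have hlow : Tendsto (fun N : ℕ => 1 / 2 - 1 / 2 * ∑ a ∈ Finset.range (n + 1),
      ∑ b ∈ Finset.range (n + 1), (2 ^ n * (2 ^ n * (n.factorial : ℝ))) ^ 2 *
        (hfun (crit n N) n a b / (N : ℝ) ^ (a + b))) atTop (𝓝 (1 / 2)) := by
    have h0 : Tendsto (fun N : ℕ => ∑ a ∈ Finset.range (n + 1),
      ∑ b ∈ Finset.range (n + 1), (2 ^ n * (2 ^ n * (n.factorial : ℝ))) ^ 2 *
        (hfun (crit n N) n a b / (N : ℝ) ^ (a + b))) atTop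
        (𝓝 (∑ a ∈ Finset.range (n + 1), ∑ b ∈ Finset.range (n + 1), 0)) := by
      refine tendsto_finsetSum _ fun a ha => tendsto_finsetSum _ fun b hb => ?_
      have ha' : a ≤ n := by simp at ha; omega
      have hb' : b ≤ n := by simp at hb; omega
      simpa using (term_tendsto hn ha' hb').const_mul ((2 ^ n * (2 ^ n * (n.factorial : ℝ))) ^ 2)
    simp only [Finset.sum_const_zero] at h0
    simpa using (h0.const_mul (1 / 2 : ℝ)).const_sub (1 / 2 : ℝ)
  refine tendsto_of_tendsto_of_tendsto_of_le_of_le' hlow hup ?_ ?_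
  · filter_upwards [eventually_ge_atTop 2, eventually_ge_atTop (2 * n)] with N hN hN2
    have hA := crit_pos hn hN
    have : Nonempty {T : Set (Fin N → Fin N → ℝ) // MeasurableSet T} :=
      ⟨⟨∅, MeasurableSet.empty⟩⟩
    refine le_ciInf fun T => ?_
    refine le_trans ?_ (testRisk_lower hn (by omega) hA T.2)
    have := Bfun_le hn hN2 hA.le
    linarith
  · filter_upwards [eventually_ge_atTop 2] with N hN
    have hA := crit_pos hn hN
    have hN0 : (0 : ℝ) < N := by
      have : 0 < N := by omega
      exact_mod_cast this
    refine (minimax_upper hn hA).trans_eq ?_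
    rw [Real.exp_neg, exp_crit hn (by omega)]
    congr 1
    field_simp

end
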